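/- Let n, m be positive integers, x a complex (2n)×m matrix with rank(x) = r and rank(xᵀ·J·x) = s, and y a complex m×(2n) matrix with y·x = 0 and (x·y)ᵀ·J = J·(x·y). Then rank(y) ≤ min(2n − r, m − r + 2·⌊(r−s)/2⌋). -/

import Mathlib

open Matrix

/-- The standard symplectic matrix `J = [[0, 1ₙ], [-1ₙ, 0]]`. -/
def symJ (n : ℕ) : Matrix (Fin n ⊕ Fin n) (Fin n ⊕ Fin n) ℂ :=
  Matrix.fromBlocks 0 1 (-1) 0

section RankLemmas

variable {K : Type*} [Field K]

theorem Submodule.finrank_map_add_finrank_inf_ker {V W : Type*} [AddCommGroup V] [Module K V]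
    [FiniteDimensional K V] [AddCommGroup W] [Module K W] (f : V →ₗ[K] W) (P : Submodule K V) :
    Module.finrank K (P.map f) + Module.finrank K (P ⊓ LinearMap.ker f : Submodule K V) =
      Module.finrank K P := by
  rw [← (f.domRestrict P).finrank_range_add_finrank_ker, LinearMap.range_domRestrict,
    LinearMap.ker_domRestrict, ← Submodule.map_comap_subtype, Submodule.finrank_map_subtype_eq]

namespace Matrix

variable {k l m n : Type*} [Fintype l] [Fintype m] [Fintype n]

/-- The Frobenius rank inequality. -/
theorem rank_mul_add_rank_mul_le [Finite k] (A : Matrix k l K) (B : Matrix l m K)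
    (C : Matrix m n K) :
    (A * B).rank + (B * C).rank ≤ (A * B * C).rank + B.rank := by
  have hB := Submodule.finrank_map_add_finrank_inf_ker A.mulVecLin (LinearMap.range B.mulVecLin)
  have hBC := Submodule.finrank_map_add_finrank_inf_ker A.mulVecLin
    (LinearMap.range (B * C).mulVecLin)
  have hle : LinearMap.range (B * C).mulVecLin ≤ LinearMap.range B.mulVecLin := by
    rw [mulVecLin_mul]
    exact LinearMap.range_comp_le_range _ _
  have hker := Submodule.finrank_mono (inf_le_inf_right (LinearMap.ker A.mulVecLin) hle)
  rw [← LinearMap.range_comp, ← mulVecLin_mul] at hB hBC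
  rw [← Matrix.mul_assoc] at hBC
  simp only [Matrix.rank]
  omega

/-- A square matrix is fixed by a projection onto its column space, factored through `K ^ rank`. -/
theorem exists_mul_mul_self_eq [DecidableEq n] (A : Matrix n n K) :
    ∃ (C : Matrix n (Fin A.rank) K) (L : Matrix (Fin A.rank) n K), C * L * A = A := by
  obtain ⟨V, U, e, hV, hU, h⟩ := A.exists_rank_normal_form
  let N : Matrix n n K := (fromBlocks 1 0 0 0).submatrix e e
  let E : Matrix n (Fin A.rank) K := (fromRows 1 0).submatrix e id
  have hN : E * Eᵀ * N = N := by
    have hE : E * Eᵀ = N := by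
      ext i j
      simp only [E, N, transpose_submatrix, mul_apply]
      cases hi : e i <;> cases hj : e j <;> simp [hi, hj, Matrix.one_apply]
    rw [hE]
    simp [N, submatrix_mul_equiv, fromBlocks_multiply]
  rw [isUnit_iff_isUnit_det] at hV hU
  refine ⟨V⁻¹ * E, Eᵀ * V, ?_⟩
  have hVA : V * A = N * U⁻¹ := by
    rw [show N = V * A * U from h.symm, mul_nonsing_inv_cancel_right _ _ hU]
  calc V⁻¹ * E * (Eᵀ * V) * A = V⁻¹ * (E * Eᵀ * (V * A)) := by simp only [Matrix.mul_assoc]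
    _ = V⁻¹ * (V * A) := by rw [hVA, ← Matrix.mul_assoc _ N, hN]
    _ = A := nonsing_inv_mul_cancel_left _ _ hV

/-- A skew-symmetric matrix in characteristic other than two has even rank. -/
theorem even_rank_of_transpose_eq_neg [NeZero (2 : K)] {A : Matrix n n K}
    (hA : Aᵀ = -A) : Even A.rank := by
  classical
  obtain ⟨C, L, hCL⟩ := A.exists_mul_mul_self_eq
  have hLC : A * (Lᵀ * Cᵀ) = A := by
    have h := congrArg transpose hCL
    rw [transpose_mul, transpose_mul, hA] at h
    simpa using h
  let G := L * A * Lᵀ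
  have hG : Gᵀ = -G := by
    simp [G, transpose_mul, hA, Matrix.mul_assoc]
  have hCG : C * (G * Cᵀ) = A := by
    calc C * (G * Cᵀ) = C * L * A * (Lᵀ * Cᵀ) := by simp only [G, Matrix.mul_assoc]
      _ = A := by rw [hCL, hLC]
  have hrank : A.rank ≤ G.rank := by
    conv_lhs => rw [← hCG]
    exact (rank_mul_le_right _ _).trans (rank_mul_le_left _ _)
  have hdet : G.det ≠ 0 := by
    intro h0
    obtain ⟨v, hv, hGv⟩ := exists_mulVec_eq_zero_iff.mpr h0
    have hker := G.mulVecLin.finrank_range_add_finrank_ker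
    have hpos : 0 < Module.finrank K (LinearMap.ker G.mulVecLin) := by
      rw [Module.finrank_pos_iff_exists_ne_zero]
      exact ⟨⟨v, hGv⟩, fun h => hv (congrArg Subtype.val h)⟩
    rw [Module.finrank_fin_fun] at hker
    simp only [Matrix.rank] at hrank hker hpos
    omega
  by_contra hodd
  have h := congrArg det hG
  rw [det_transpose, det_neg, Fintype.card_fin, (Nat.not_even_iff_odd.mp hodd).neg_one_pow,
    neg_one_mul, eq_neg_iff_add_eq_zero, ← two_mul] at h
  exact (mul_ne_zero (NeZero.ne 2) hdet) h

end Matrix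

end RankLemmas

theorem symJ_transpose (n : ℕ) : (symJ n)ᵀ = -symJ n := by
  simp [symJ, fromBlocks_transpose, fromBlocks_neg]

theorem symJ_mul_self (n : ℕ) : symJ n * symJ n = -1 := by
  rw [← fromBlocks_one]
  simp [symJ, fromBlocks_multiply, fromBlocks_neg, -fromBlocks_one]

theorem isUnit_det_symJ (n : ℕ) : IsUnit (symJ n).det :=
  isUnit_det_of_left_inverse (B := -symJ n) (by rw [neg_mul, symJ_mul_self, neg_neg])

/-- Rank bound for elements of the conormal space at `x ∈ O_{rs}`. -/
theorem conormal_rank_bound (n m : ℕ) (hn : 0 < n) (hm : 0 < m) (r s : ℕ)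
    (x : Matrix (Fin n ⊕ Fin n) (Fin m) ℂ)
    (hxr : x.rank = r) (hxs : (xᵀ * symJ n * x).rank = s)
    (y : Matrix (Fin m) (Fin n ⊕ Fin n) ℂ)
    (hyx : y * x = 0) (hsymm : (x * y)ᵀ * symJ n = symJ n * (x * y)) :
    y.rank ≤ min (2 * n - r) (m - r + 2 * ((r - s) / 2)) := by
  have hyx_rank := rank_add_rank_le_card_of_mul_eq_zero hyx
  have hsylvester := rank_mul_add_rank_mul_le x (1 : Matrix (Fin m) (Fin m) ℂ) y
  have hzero : xᵀ * symJ n * x * y = 0 := by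
    calc xᵀ * symJ n * x * y = xᵀ * ((x * y)ᵀ * symJ n) := by
          rw [hsymm]; simp only [Matrix.mul_assoc]
      _ = (x * (y * x))ᵀ * symJ n := by simp only [transpose_mul, Matrix.mul_assoc]
      _ = 0 := by simp [hyx]
  have hfrobenius := rank_mul_add_rank_mul_le (xᵀ * symJ n) x y
  have heven : Even (symJ n * (x * y)).rank := by
    apply even_rank_of_transpose_eq_neg
    rw [transpose_mul, symJ_transpose, Matrix.mul_neg, hsymm]
  rw [rank_mul_eq_right_of_isUnit_det _ _ (isUnit_det_symJ n)] at heven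
  obtain ⟨t, ht⟩ := heven
  rw [hzero, rank_zero, hxs, hxr] at hfrobenius
  simp only [Matrix.mul_one, Matrix.one_mul, rank_one, Fintype.card_fin, Fintype.card_sum, hxr]
    at hsylvester hyx_rank
  omega
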